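/- Let V: ℝⁿ → ℝ be measurable with e^V + e^{−V} ∈ L¹_loc(ℝⁿ). Then there exists a sequence of functions V_i: ℝⁿ → ℝ which are simultaneously globally Lipschitz and C^∞, with inf_{ℝⁿ} V_i > −∞ for each i, such that V_i → V pointwise a.e., and e^{V_i} → e^V and e^{−V_i} → e^{−V} in L¹(B) for every ball B ⊂ ℝⁿ. Moreover, if in addition e^{−V} ∈ L¹(ℝⁿ), the sequence can be chosen so that also e^{−V_i} → e^{−V} in L¹(ℝⁿ). -/

import Mathlib

open MeasureTheory Set Filter Metric

noncomputable section

/-- Euclidean space `ℝⁿ`. -/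
abbrev Spc (n : ℕ) := EuclideanSpace ℝ (Fin n)

/-- `Vi` is an admissible approximating sequence for the potential `V`:
each `Vi i` is globally Lipschitz, smooth and bounded below, `Vi → V` pointwise a.e.,
and `e^{Vi} → e^V`, `e^{-Vi} → e^{-V}` in `L¹(B)` for every ball `B`. -/
def ApproxSeq (n : ℕ) (V : Spc n → ℝ) (Vi : ℕ → Spc n → ℝ) : Prop :=
  (∀ i, ContDiff ℝ (⊤ : ℕ∞) (Vi i) ∧ (∃ K : NNReal, LipschitzWith K (Vi i)) ∧
    BddBelow (range (Vi i))) ∧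
  (∀ᵐ x : Spc n, Tendsto (fun i => Vi i x) atTop (nhds (V x))) ∧
  (∀ (c : Spc n) (r : ℝ),
    Tendsto (fun i => ∫ x in ball c r, |Real.exp (Vi i x) - Real.exp (V x)|)
      atTop (nhds 0)) ∧
  (∀ (c : Spc n) (r : ℝ),
    Tendsto (fun i => ∫ x in ball c r, |Real.exp (-(Vi i x)) - Real.exp (-V x)|)
      atTop (nhds 0))

/-- Smooth, globally Lipschitz functions that are bounded below. -/
def IsNicePotential {n : ℕ} (W : Spc n → ℝ) : Prop :=
  ContDiff ℝ (⊤ : ℕ∞) W ∧ (∃ K : NNReal, LipschitzWith K W) ∧ BddBelow (range W)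

/-- `e^u` and `e^{-u}` can be approximated in `L¹(μ)` and `L¹(ν)` respectively by the
exponentials of a single smooth, Lipschitz potential that is bounded below. -/
def IsExpApproximable {n : ℕ} (μ ν : Measure (Spc n)) (u : Spc n → ℝ) : Prop :=
  ∀ ε : ENNReal, 0 < ε → ∃ W : Spc n → ℝ, IsNicePotential W ∧
    ∫⁻ x, ‖Real.exp (W x) - Real.exp (u x)‖ₑ ∂μ < ε ∧
    ∫⁻ x, ‖Real.exp (-(W x)) - Real.exp (-(u x))‖ₑ ∂ν < ε

lemma IsNicePotential.add {n : ℕ} {f g : Spc n → ℝ} (hf : IsNicePotential f)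
    (hg : IsNicePotential g) : IsNicePotential (fun x => f x + g x) := by
  obtain ⟨hf1, ⟨K, hK⟩, ⟨a, ha⟩⟩ := hf
  obtain ⟨hg1, ⟨L, hL⟩, ⟨b, hb⟩⟩ := hg
  refine ⟨hf1.add hg1, ⟨K + L, hK.add hL⟩, ⟨a + b, ?_⟩⟩
  rintro _ ⟨x, rfl⟩
  exact add_le_add (ha ⟨x, rfl⟩) (hb ⟨x, rfl⟩)

lemma IsNicePotential.isExpApproximable {n : ℕ} {W : Spc n → ℝ} (hW : IsNicePotential W)
    (μ ν : Measure (Spc n)) : IsExpApproximable μ ν W :=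
  fun ε hε => ⟨W, hW, by simpa using hε, by simpa using hε⟩

lemma lintegral_enorm_sub_lt_of_lt_half {α : Type*} [MeasurableSpace α] {μ : Measure α}
    {f g h : α → ℝ} {ε : ENNReal} (hf : Measurable f) (hg : Measurable g)
    (hfg : ∫⁻ x, ‖f x - g x‖ₑ ∂μ < ε / 2) (hgh : ∫⁻ x, ‖g x - h x‖ₑ ∂μ < ε / 2) :
    ∫⁻ x, ‖f x - h x‖ₑ ∂μ < ε := by
  calc ∫⁻ x, ‖f x - h x‖ₑ ∂μ ≤ ∫⁻ x, (‖f x - g x‖ₑ + ‖g x - h x‖ₑ) ∂μ := by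
        refine lintegral_mono fun x => ?_
        have : f x - h x = (f x - g x) + (g x - h x) := by ring
        simp only [this]
        exact enorm_add_le _ _
    _ = ∫⁻ x, ‖f x - g x‖ₑ ∂μ + ∫⁻ x, ‖g x - h x‖ₑ ∂μ :=
        lintegral_add_left (hf.sub hg).enorm _
    _ < ε / 2 + ε / 2 := ENNReal.add_lt_add hfg hgh
    _ = ε := ENNReal.add_halves ε

/-- Exponential approximability is preserved by dominated almost everywhere limits. -/
lemma isExpApproximable_of_tendsto {n : ℕ} {μ ν : Measure (Spc n)} {u : Spc n → ℝ}
    {uj : ℕ → Spc n → ℝ} (hmeas : ∀ j, Measurable (uj j))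
    (happ : ∀ j, IsExpApproximable μ ν (uj j))
    {b c : Spc n → ℝ} (hb : Integrable b μ) (hc : Integrable c ν)
    (hub : ∀ j, ∀ᵐ x ∂μ, Real.exp (uj j x) ≤ b x)
    (huc : ∀ j, ∀ᵐ x ∂ν, Real.exp (-(uj j x)) ≤ c x)
    (hμ : ∀ᵐ x ∂μ, Tendsto (fun j => uj j x) atTop (nhds (u x)))
    (hν : ∀ᵐ x ∂ν, Tendsto (fun j => uj j x) atTop (nhds (u x))) :
    IsExpApproximable μ ν u := by
  intro ε hε
  have h1 := tendsto_lintegral_norm_of_dominated_convergence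
    (F := fun j x => Real.exp (uj j x)) (f := fun x => Real.exp (u x))
    (fun j => (hmeas j).exp.aestronglyMeasurable) hb.hasFiniteIntegral
    (fun j => by simpa using hub j)
    (hμ.mono fun x hx => (Real.continuous_exp.tendsto _).comp hx)
  have h2 := tendsto_lintegral_norm_of_dominated_convergence
    (F := fun j x => Real.exp (-(uj j x))) (f := fun x => Real.exp (-(u x)))
    (fun j => (hmeas j).neg.exp.aestronglyMeasurable) hc.hasFiniteIntegral
    (fun j => by simpa using huc j)
    (hν.mono fun x hx => (Real.continuous_exp.tendsto _).comp hx.neg)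
  simp only [ofReal_norm] at h1 h2
  have hε2 : 0 < ε / 2 := ENNReal.half_pos hε.ne'
  obtain ⟨j, hj1, hj2⟩ := ((h1.eventually_lt_const hε2).and (h2.eventually_lt_const hε2)).exists
  obtain ⟨W, hW, hW1, hW2⟩ := happ j (ε / 2) hε2
  have hWm : Measurable W := hW.1.continuous.measurable
  exact ⟨W, hW, lintegral_enorm_sub_lt_of_lt_half hWm.exp (hmeas j).exp hW1 hj1,
    lintegral_enorm_sub_lt_of_lt_half hWm.neg.exp (hmeas j).neg.exp hW2 hj2⟩

lemma abs_sqrt_one_add_sq_sub_le (a b : ℝ) :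
    |√(1 + a ^ 2) - √(1 + b ^ 2)| ≤ |a - b| := by
  have ha := Real.sq_sqrt (show 0 ≤ 1 + a ^ 2 by positivity)
  have hb := Real.sq_sqrt (show 0 ≤ 1 + b ^ 2 by positivity)
  have hab : 1 + a * b ≤ √(1 + a ^ 2) * √(1 + b ^ 2) := by
    rw [← Real.sqrt_mul (by positivity)]
    exact Real.le_sqrt_of_sq_le (by nlinarith [sq_nonneg (a - b)])
  exact sq_le_sq.mp (by nlinarith)

lemma isNicePotential_const_mul_sqrt {n : ℕ} {δ : ℝ} (hδ : 0 ≤ δ) :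
    IsNicePotential (fun x : Spc n => δ * √(1 + ‖x‖ ^ 2)) := by
  refine ⟨?_, ⟨⟨δ, hδ⟩, ?_⟩, ⟨0, ?_⟩⟩
  · exact contDiff_const.mul
      ((contDiff_const.add (contDiff_norm_sq ℝ)).sqrt fun x => by positivity)
  · refine LipschitzWith.of_dist_le_mul fun x y => ?_
    rw [Real.dist_eq, ← mul_sub, abs_mul, abs_of_nonneg hδ, dist_eq_norm]
    exact mul_le_mul_of_nonneg_left
      ((abs_sqrt_one_add_sq_sub_le _ _).trans (abs_norm_sub_norm_le x y)) hδ
  · rintro _ ⟨x, rfl⟩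
    positivity

lemma integrable_exp_neg_const_mul_sqrt {n : ℕ} {δ : ℝ} (hδ : 0 < δ) :
    Integrable (fun x : Spc n => Real.exp (-(δ * √(1 + ‖x‖ ^ 2)))) := by
  have h := integrable_rpow_neg_one_add_norm_sq (E := Spc n) (μ := volume)
    (r := ((n + 1 : ℕ) : ℝ)) (by simp)
  refine (h.const_mul (((n + 1).factorial : ℝ) / δ ^ (n + 1))).mono'
    (Continuous.aestronglyMeasurable (by fun_prop)) (ae_of_all _ fun x => ?_)
  have hs : 0 < √(1 + ‖x‖ ^ 2) := Real.sqrt_pos.2 (by positivity)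
  have hpow : (1 + ‖x‖ ^ 2) ^ (-((n + 1 : ℕ) : ℝ) / 2) = (√(1 + ‖x‖ ^ 2) ^ (n + 1))⁻¹ := by
    rw [Real.sqrt_eq_rpow, ← Real.rpow_natCast _ (n + 1), ← Real.rpow_mul (by positivity),
      ← Real.rpow_neg (by positivity)]
    congr 1
    ring
  have hexp := Real.pow_div_factorial_le_exp (x := δ * √(1 + ‖x‖ ^ 2)) (by positivity) (n + 1)
  rw [hpow, Real.norm_of_nonneg (Real.exp_nonneg _), Real.exp_neg]
  calc (Real.exp (δ * √(1 + ‖x‖ ^ 2)))⁻¹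
      ≤ ((δ * √(1 + ‖x‖ ^ 2)) ^ (n + 1) / ((n + 1).factorial : ℝ))⁻¹ :=
        inv_anti₀ (by positivity) hexp
    _ = _ := by
        rw [mul_pow]
        field_simp

/-- A bounded measurable function with bounded support is the almost everywhere limit of
smooth compactly supported functions obeying the same bound. -/
lemma exists_seq_contDiff_hasCompactSupport_tendsto {n : ℕ} {f : Spc n → ℝ} {k R : ℝ}
    (hf : Measurable f) (hk : ∀ x, |f x| ≤ k) (hR : ∀ x, x ∉ ball 0 R → f x = 0) :
    ∃ g : ℕ → Spc n → ℝ, (∀ j, ContDiff ℝ (⊤ : ℕ∞) (g j)) ∧ (∀ j, HasCompactSupport (g j)) ∧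
      (∀ j x, |g j x| ≤ k) ∧ ∀ᵐ x, Tendsto (fun j => g j x) atTop (nhds (f x)) := by
  have hk0 : 0 ≤ k := (abs_nonneg _).trans (hk 0)
  have hcs : HasCompactSupport f :=
    HasCompactSupport.intro (isCompact_closedBall 0 R)
      fun x hx => hR x fun h => hx (ball_subset_closedBall h)
  have hloc : LocallyIntegrable f := by
    refine (locallyIntegrable_const k).mono hf.aestronglyMeasurable (ae_of_all _ fun x => ?_)
    rw [Real.norm_of_nonneg hk0]
    exact hk x
  let φ : ℕ → ContDiffBump (0 : Spc n) := fun j =>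
    { rIn := 1 / ((j : ℝ) + 1)
      rOut := 2 * (1 / ((j : ℝ) + 1))
      rIn_pos := by positivity
      rIn_lt_rOut := by
        have : 0 < 1 / ((j : ℝ) + 1) := by positivity
        linarith }
  refine ⟨fun j => convolution ((φ j).normed volume) f (ContinuousLinearMap.lsmul ℝ ℝ) volume,
    fun j => ?_, fun j => ?_, fun j x => ?_, ?_⟩
  · exact (φ j).hasCompactSupport_normed.contDiff_convolution_left _ (φ j).contDiff_normed hloc
  · exact (φ j).hasCompactSupport_normed.convolution _ hcs
  · have := dist_convolution_le (z₀ := (0 : ℝ)) (x₀ := x) (μ := (volume : Measure (Spc n))) hk0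
      (φ j).support_normed_eq.subset (φ j).nonneg_normed (φ j).integral_normed
      hf.aestronglyMeasurable (fun y _ => by simpa using hk y)
    simpa using this
  · refine ContDiffBump.ae_convolution_tendsto_right_of_locallyIntegrable (K := 2) ?_
      (Eventually.of_forall fun j => le_rfl) hloc
    have h := (tendsto_one_div_add_atTop_nhds_zero_nat (𝕜 := ℝ)).const_mul 2
    rwa [mul_zero] at h

lemma isNicePotential_of_hasCompactSupport {n : ℕ} {g : Spc n → ℝ}
    (hg : ContDiff ℝ (⊤ : ℕ∞) g) (hc : HasCompactSupport g) : IsNicePotential g :=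
  ⟨hg, ContDiff.lipschitzWith_of_hasCompactSupport hc hg (by simp),
    (hc.isCompact_range hg.continuous).bddBelow⟩

section Approximation

variable {n : ℕ} {δ : ℝ} {r : ℝ} {S : Set (Spc n)} {V : Spc n → ℝ}

lemma sqrt_one_add_norm_sq_le_of_mem_ball {x : Spc n} (hx : x ∈ ball 0 r) :
    √(1 + ‖x‖ ^ 2) ≤ √(1 + r ^ 2) := by
  have : ‖x‖ < r := by simpa using hx
  gcongr

lemma isExpApproximable_add_sqrt_of_bounded (hδ : 0 < δ) {k R : ℝ} {f : Spc n → ℝ}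
    (hf : Measurable f) (hk : ∀ x, |f x| ≤ k) (hR : ∀ x, x ∉ ball 0 R → f x = 0) :
    IsExpApproximable (volume.restrict (ball 0 r)) (volume.restrict S)
      (fun x => f x + δ * √(1 + ‖x‖ ^ 2)) := by
  obtain ⟨g, hg, hgc, hgk, hgt⟩ := exists_seq_contDiff_hasCompactSupport_tendsto hf hk hR
  have hnice : ∀ j, IsNicePotential (fun x => g j x + δ * √(1 + ‖x‖ ^ 2)) := fun j =>
    (isNicePotential_of_hasCompactSupport (hg j) (hgc j)).add (isNicePotential_const_mul_sqrt hδ.le)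
  have ht : ∀ᵐ x, Tendsto (fun j => g j x + δ * √(1 + ‖x‖ ^ 2)) atTop
      (nhds (f x + δ * √(1 + ‖x‖ ^ 2))) := hgt.mono fun x hx => hx.add_const _
  refine isExpApproximable_of_tendsto (fun j => (hnice j).1.continuous.measurable)
    (fun j => (hnice j).isExpApproximable _ _)
    (b := fun _ => Real.exp (k + δ * √(1 + r ^ 2)))
    (c := fun x => Real.exp k * Real.exp (-(δ * √(1 + ‖x‖ ^ 2))))
    (integrableOn_const measure_ball_lt_top.ne)
    ((integrable_exp_neg_const_mul_sqrt hδ).const_mul _).integrableOn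
    (fun j => ae_restrict_of_forall_mem measurableSet_ball fun x hx => ?_)
    (fun j => ae_of_all _ fun x => ?_) (ae_restrict_of_ae ht) (ae_restrict_of_ae ht)
  · have := le_of_abs_le (hgk j x)
    have := sqrt_one_add_norm_sq_le_of_mem_ball hx
    gcongr
  · have := neg_le_of_abs_le (hgk j x)
    rw [← Real.exp_add]
    gcongr
    linarith

/-- The truncation of a function to values in `[-k, k]` and to the ball of radius `k`. -/
def truncatePotential (V : Spc n → ℝ) (k : ℕ) : Spc n → ℝ :=
  (ball 0 (k : ℝ)).indicator fun x => max (-(k : ℝ)) (min (k : ℝ) (V x))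

lemma measurable_truncatePotential (hV : Measurable V) (k : ℕ) :
    Measurable (truncatePotential V k) :=
  (measurable_const.max (measurable_const.min hV)).indicator measurableSet_ball

lemma abs_truncatePotential_le (V : Spc n → ℝ) (k : ℕ) (x : Spc n) :
    |truncatePotential V k x| ≤ k := by
  have hk : (0 : ℝ) ≤ k := k.cast_nonneg
  unfold truncatePotential
  by_cases hx : x ∈ ball (0 : Spc n) (k : ℝ)
  · rw [indicator_of_mem hx, abs_le]
    exact ⟨le_max_left _ _, max_le (by linarith) (min_le_left _ _)⟩
  · rw [indicator_of_notMem hx, abs_zero]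
    exact hk

lemma truncatePotential_le_max (V : Spc n → ℝ) (k : ℕ) (x : Spc n) :
    truncatePotential V k x ≤ max (V x) 0 := by
  have hk : (0 : ℝ) ≤ k := k.cast_nonneg
  unfold truncatePotential
  by_cases hx : x ∈ ball (0 : Spc n) (k : ℝ)
  · rw [indicator_of_mem hx]
    exact max_le ((neg_nonpos.2 hk).trans (le_max_right _ _))
      ((min_le_right _ _).trans (le_max_left _ _))
  · rw [indicator_of_notMem hx]
    exact le_max_right _ _

lemma min_le_truncatePotential (V : Spc n → ℝ) (k : ℕ) (x : Spc n) :
    min (V x) 0 ≤ truncatePotential V k x := by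
  have hk : (0 : ℝ) ≤ k := k.cast_nonneg
  unfold truncatePotential
  by_cases hx : x ∈ ball (0 : Spc n) (k : ℝ)
  · rw [indicator_of_mem hx]
    exact le_max_of_le_right (le_min ((min_le_right _ _).trans hk) (min_le_left _ _))
  · rw [indicator_of_notMem hx]
    exact min_le_right _ _

lemma tendsto_truncatePotential (V : Spc n → ℝ) (x : Spc n) :
    Tendsto (fun k => truncatePotential V k x) atTop (nhds (V x)) := by
  refine tendsto_const_nhds.congr' ?_
  obtain ⟨N, hN⟩ := exists_nat_gt (max ‖x‖ |V x|)
  filter_upwards [eventually_ge_atTop N] with k hk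
  have hkN : (N : ℝ) ≤ k := by exact_mod_cast hk
  have h1 : ‖x‖ < k := (le_max_left _ _).trans_lt (hN.trans_le hkN)
  have h2 := abs_le.1 ((le_max_right ‖x‖ |V x|).trans (hN.trans_le hkN).le)
  rw [truncatePotential, indicator_of_mem (by simpa using h1), min_eq_right h2.2,
    max_eq_right h2.1]

lemma exp_le_exp_add_one_of_le_max {a b : ℝ} (h : a ≤ max b 0) :
    Real.exp a ≤ Real.exp b + 1 := by
  rcases le_max_iff.1 h with h | h
  · linarith [Real.exp_le_exp.2 h]
  · linarith [Real.exp_le_one_iff.2 h, Real.exp_pos b]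

lemma isExpApproximable_add_sqrt (hδ : 0 < δ) (hV : Measurable V)
    (hp : IntegrableOn (fun x => Real.exp (V x)) (ball 0 r))
    (hm : IntegrableOn (fun x => Real.exp (-V x)) S) :
    IsExpApproximable (volume.restrict (ball 0 r)) (volume.restrict S)
      (fun x => V x + δ * √(1 + ‖x‖ ^ 2)) := by
  have ht : ∀ x, Tendsto (fun k => truncatePotential V k x + δ * √(1 + ‖x‖ ^ 2)) atTop
      (nhds (V x + δ * √(1 + ‖x‖ ^ 2))) := fun x => (tendsto_truncatePotential V x).add_const _
  refine isExpApproximable_of_tendsto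
    (uj := fun k x => truncatePotential V k x + δ * √(1 + ‖x‖ ^ 2))
    (fun k => (measurable_truncatePotential hV k).add (by fun_prop))
    (fun k => isExpApproximable_add_sqrt_of_bounded hδ (measurable_truncatePotential hV k)
      (abs_truncatePotential_le V k) fun x hx => indicator_of_notMem hx _)
    (b := fun x => (Real.exp (V x) + 1) * Real.exp (δ * √(1 + r ^ 2)))
    (c := fun x => Real.exp (-V x) + Real.exp (-(δ * √(1 + ‖x‖ ^ 2))))
    ((hp.add (integrableOn_const measure_ball_lt_top.ne)).mul_const _)
    (hm.add (integrable_exp_neg_const_mul_sqrt hδ).integrableOn)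
    (fun k => ae_restrict_of_forall_mem measurableSet_ball fun x hx => ?_)
    (fun k => ae_of_all _ fun x => ?_) (ae_of_all _ ht) (ae_of_all _ ht)
  · have := sqrt_one_add_norm_sq_le_of_mem_ball hx
    have := exp_le_exp_add_one_of_le_max (truncatePotential_le_max V k x)
    rw [Real.exp_add]
    gcongr
  · have hs : 0 ≤ δ * √(1 + ‖x‖ ^ 2) := by positivity
    rcases min_le_iff.1 (min_le_truncatePotential V k x) with h | h
    · have := Real.exp_pos (-(δ * √(1 + ‖x‖ ^ 2)))
      have := Real.exp_le_exp.2
        (show -(truncatePotential V k x + δ * √(1 + ‖x‖ ^ 2)) ≤ -V x by linarith)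
      linarith
    · have := Real.exp_pos (-V x)
      have := Real.exp_le_exp.2
        (show -(truncatePotential V k x + δ * √(1 + ‖x‖ ^ 2)) ≤ -(δ * √(1 + ‖x‖ ^ 2)) by linarith)
      linarith

lemma isExpApproximable_of_integrableOn (hV : Measurable V)
    (hp : IntegrableOn (fun x => Real.exp (V x)) (ball 0 r))
    (hm : IntegrableOn (fun x => Real.exp (-V x)) S) :
    IsExpApproximable (volume.restrict (ball 0 r)) (volume.restrict S) V := by
  have ht : ∀ x : Spc n, Tendsto (fun j : ℕ => V x + 1 / ((j : ℝ) + 1) * √(1 + ‖x‖ ^ 2)) atTop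
      (nhds (V x)) := fun x => by
    simpa using ((tendsto_one_div_add_atTop_nhds_zero_nat (𝕜 := ℝ)).mul_const
      (√(1 + ‖x‖ ^ 2))).const_add (V x)
  refine isExpApproximable_of_tendsto
    (uj := fun j x => V x + 1 / ((j : ℝ) + 1) * √(1 + ‖x‖ ^ 2))
    (fun j => hV.add (by fun_prop))
    (fun j => isExpApproximable_add_sqrt (by positivity) hV hp hm)
    (b := fun x => Real.exp (V x) * Real.exp (√(1 + r ^ 2)))
    (hp.mul_const _) hm
    (fun j => ae_restrict_of_forall_mem measurableSet_ball fun x hx => ?_)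
    (fun j => ae_of_all _ fun x => ?_) (ae_of_all _ ht) (ae_of_all _ ht)
  · have h1 := sqrt_one_add_norm_sq_le_of_mem_ball hx
    have h2 : 1 / ((j : ℝ) + 1) ≤ 1 := by
      rw [div_le_one (by positivity)]
      linarith [(j.cast_nonneg : (0 : ℝ) ≤ j)]
    rw [Real.exp_add]
    gcongr
    exact (mul_le_of_le_one_left (Real.sqrt_nonneg _) h2).trans h1
  · have : 0 ≤ 1 / ((j : ℝ) + 1) * √(1 + ‖x‖ ^ 2) := by positivity
    gcongr
    linarith

end Approximation

lemma tendsto_integral_abs_of_lintegral_enorm_le {α : Type*} [MeasurableSpace α]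
    {μ : ℕ → Measure α} {f : ℕ → α → ℝ} (hf : ∀ i, Measurable (f i)) {e : ℕ → ENNReal}
    (he : Tendsto e atTop (nhds 0)) (hfe : ∀ᶠ i in atTop, ∫⁻ x, ‖f i x‖ₑ ∂μ i ≤ e i) :
    Tendsto (fun i => ∫ x, |f i x| ∂μ i) atTop (nhds 0) := by
  have h0 : Tendsto (fun i => ∫⁻ x, ‖f i x‖ₑ ∂μ i) atTop (nhds 0) :=
    tendsto_of_tendsto_of_tendsto_of_le_of_le' tendsto_const_nhds he
      (Eventually.of_forall fun i => zero_le) hfe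
  have h1 := (ENNReal.tendsto_toReal ENNReal.zero_ne_top).comp h0
  refine h1.congr fun i => ?_
  exact (integral_norm_eq_lintegral_enorm (hf i).aestronglyMeasurable).symm

lemma exists_nat_forall_ball_subset {n : ℕ} (c : Spc n) (r : ℝ) :
    ∃ N : ℕ, ∀ i ≥ N, ball c r ⊆ ball (0 : Spc n) (i : ℝ) := by
  obtain ⟨N, hN⟩ := exists_nat_ge (r + dist c 0)
  refine ⟨N, fun i hi => ball_subset_ball' (hN.trans ?_)⟩
  exact_mod_cast hi

/-- Summable `L¹` errors on the balls of radius `i` imply almost everywhere convergence. -/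
lemma ae_tendsto_of_setLIntegral_ball_le {n : ℕ} {f : ℕ → Spc n → ℝ}
    (hf : ∀ i, Measurable (f i)) {e : ℕ → ENNReal} (he : ∑' i, e i ≠ ⊤)
    (hfe : ∀ i : ℕ, ∫⁻ x in ball (0 : Spc n) (i : ℝ), ‖f i x‖ₑ ≤ e i) :
    ∀ᵐ x, Tendsto (fun i => f i x) atTop (nhds 0) := by
  have hm : ∀ i : ℕ, Measurable ((ball (0 : Spc n) (i : ℝ)).indicator fun x => ‖f i x‖ₑ) :=
    fun i => (hf i).enorm.indicator measurableSet_ball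
  have hfin : ∫⁻ x, ∑' i : ℕ, (ball (0 : Spc n) (i : ℝ)).indicator (fun x => ‖f i x‖ₑ) x ≠ ⊤ := by
    rw [lintegral_tsum fun i => (hm i).aemeasurable]
    refine ne_top_of_le_ne_top he (ENNReal.tsum_le_tsum fun i => ?_)
    rw [lintegral_indicator measurableSet_ball]
    exact hfe i
  filter_upwards [ae_lt_top (Measurable.tsum hm) hfin] with x hx
  rw [tendsto_zero_iff_enorm_tendsto_zero]
  refine (ENNReal.tendsto_atTop_zero_of_tsum_ne_top hx.ne).congr' ?_
  obtain ⟨N, hN⟩ := exists_nat_forall_ball_subset x 1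
  filter_upwards [eventually_ge_atTop N] with i hi
  exact indicator_of_mem (hN i hi (mem_ball_self one_pos)) _

lemma exists_approxSeq_of_isExpApproximable {n : ℕ} {V : Spc n → ℝ} (hV : Measurable V)
    {S : ℕ → Set (Spc n)} (hS : ∀ i : ℕ, ball 0 (i : ℝ) ⊆ S i)
    (happ : ∀ i : ℕ, IsExpApproximable (volume.restrict (ball 0 (i : ℝ)))
      (volume.restrict (S i)) V) :
    ∃ Vi : ℕ → Spc n → ℝ, ApproxSeq n V Vi ∧
      Tendsto (fun i => ∫ x in S i, |Real.exp (-(Vi i x)) - Real.exp (-V x)|) atTop (nhds 0) := by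
  obtain ⟨e, he0, hesum⟩ := ENNReal.exists_pos_sum_of_countable' one_ne_zero ℕ
  have he : ∑' i, e i ≠ ⊤ := hesum.ne_top
  have het : Tendsto e atTop (nhds 0) := ENNReal.tendsto_atTop_zero_of_tsum_ne_top he
  choose W hW hWp hWm using fun i => happ i (e i) (he0 i)
  have hWmeas : ∀ i, Measurable (W i) := fun i => (hW i).1.continuous.measurable
  have hp : ∀ i, Measurable fun x => Real.exp (W i x) - Real.exp (V x) :=
    fun i => (hWmeas i).exp.sub hV.exp
  have hm : ∀ i, Measurable fun x => Real.exp (-(W i x)) - Real.exp (-V x) :=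
    fun i => (hWmeas i).neg.exp.sub hV.neg.exp
  refine ⟨W, ⟨hW, ?_, fun c r => ?_, fun c r => ?_⟩, ?_⟩
  · filter_upwards [ae_tendsto_of_setLIntegral_ball_le hp he fun i => (hWp i).le] with x hx
    have hexp : Tendsto (fun i => Real.exp (W i x)) atTop (nhds (Real.exp (V x))) := by
      simpa using hx.add_const (Real.exp (V x))
    simpa using hexp.log (Real.exp_ne_zero _)
  · obtain ⟨N, hN⟩ := exists_nat_forall_ball_subset c r
    refine tendsto_integral_abs_of_lintegral_enorm_le hp het ?_
    filter_upwards [eventually_ge_atTop N] with i hi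
    exact (lintegral_mono_set (hN i hi)).trans (hWp i).le
  · obtain ⟨N, hN⟩ := exists_nat_forall_ball_subset c r
    refine tendsto_integral_abs_of_lintegral_enorm_le hm het ?_
    filter_upwards [eventually_ge_atTop N] with i hi
    exact (lintegral_mono_set ((hN i hi).trans (hS i))).trans (hWm i).le
  · exact tendsto_integral_abs_of_lintegral_enorm_le hm het
      (Eventually.of_forall fun i => (hWm i).le)

/-- **Approximation of potentials** (Lemma 4.3):
if `V` is measurable with `e^V + e^{-V} ∈ L¹_loc(ℝⁿ)`, then there exists a sequence of
smooth globally Lipschitz potentials `Vi`, bounded below, converging pointwise a.e. to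
`V` and such that `e^{±Vi} → e^{±V}` in `L¹_loc`; moreover, if `e^{-V} ∈ L¹(ℝⁿ)`, the
sequence can be chosen so that also `e^{-Vi} → e^{-V}` in `L¹(ℝⁿ)`. -/
theorem approximation_of_potentials
    (n : ℕ) (V : Spc n → ℝ) (hV : Measurable V)
    (hloc : ∀ (c : Spc n) (r : ℝ),
      IntegrableOn (fun x => Real.exp (V x) + Real.exp (-V x)) (ball c r)) :
    (∃ Vi : ℕ → Spc n → ℝ, ApproxSeq n V Vi) ∧
    (Integrable (fun x => Real.exp (-V x)) →
      ∃ Vi : ℕ → Spc n → ℝ, ApproxSeq n V Vi ∧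
        Tendsto (fun i => ∫ x, |Real.exp (-(Vi i x)) - Real.exp (-V x)|)
          atTop (nhds 0)) := by
  have hp : ∀ c r, IntegrableOn (fun x => Real.exp (V x)) (ball c r) := fun c r =>
    (hloc c r).mono' hV.exp.aestronglyMeasurable (ae_of_all _ fun x => by
      rw [Real.norm_of_nonneg (Real.exp_nonneg _)]
      linarith [Real.exp_pos (-V x)])
  have hm : ∀ c r, IntegrableOn (fun x => Real.exp (-V x)) (ball c r) := fun c r =>
    (hloc c r).mono' hV.neg.exp.aestronglyMeasurable (ae_of_all _ fun x => by
      rw [Real.norm_of_nonneg (Real.exp_nonneg _)]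
      linarith [Real.exp_pos (V x)])
  refine ⟨?_, fun hint => ?_⟩
  · obtain ⟨Vi, hVi, -⟩ := exists_approxSeq_of_isExpApproximable hV
      (S := fun i => ball 0 (i : ℝ)) (fun _ => Subset.rfl)
      fun i => isExpApproximable_of_integrableOn hV (hp 0 i) (hm 0 i)
    exact ⟨Vi, hVi⟩
  · obtain ⟨Vi, hVi, hlim⟩ := exists_approxSeq_of_isExpApproximable hV
      (S := fun _ => univ) (fun _ => subset_univ _)
      fun i => isExpApproximable_of_integrableOn hV (hp 0 i) hint.integrableOn
    exact ⟨Vi, hVi, by simpa using hlim⟩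

end
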